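/- Fix n ≥ 2 and let X = {w ∈ 𝔇_n : w_2 < w_3 < ⋯ < w_n} (the signed permutations in 𝔇_n whose type D descent set is contained in {1,−1}). Then Σ_{w∈X} t^{odes_D(w)} s^{edes_D(w)} q^{inv_D(w)} = t²·D_n(1,q)/[n−1]_q! + t(1−t)·(2·D_n(1,q)/[n]_q! − 1) + (1−t), an identity of polynomials in t and q (every w ∈ X has edes_D(w) = 0, and D_n(1,q)/[n−1]_q! and 2·D_n(1,q)/[n]_q! are polynomials in q). -/

import Mathlib

open Finset

/-- The hyperoctahedral group `𝔅_n`, encoded as (permutation of positions, signs):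
the signed permutation sends `i+1` to `±(σ i + 1)`. -/
abbrev BG (n : ℕ) := Equiv.Perm (Fin n) × (Fin n → Bool)

/-- The value `π_i` (for `1 ≤ i ≤ n`) of the signed permutation, with `π_0 = 0`. -/
def bval {n : ℕ} (w : BG n) (i : ℕ) : ℤ :=
  if h : 1 ≤ i ∧ i ≤ n then
    (if w.2 ⟨i - 1, by omega⟩ then -1 else 1) * (((w.1 ⟨i - 1, by omega⟩ : Fin n) : ℕ) + 1 : ℤ)
  else 0

/-- `edes_B`: even `i ∈ {0,…,n−1}` with `π_i > π_{i+1}`. -/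
def edesB {n : ℕ} (w : BG n) : ℕ :=
  ((range n).filter fun i => Even i ∧ bval w (i + 1) < bval w i).card

/-- `odes_B`: odd `i ∈ {0,…,n−1}` with `π_i > π_{i+1}`. -/
def odesB {n : ℕ} (w : BG n) : ℕ :=
  ((range n).filter fun i => Odd i ∧ bval w (i + 1) < bval w i).card

/-- `easc_B`: even `i ∈ {0,…,n−1}` with `π_i < π_{i+1}`. -/
def eascB {n : ℕ} (w : BG n) : ℕ :=
  ((range n).filter fun i => Even i ∧ bval w i < bval w (i + 1)).card

/-- `oasc_B`: odd `i ∈ {0,…,n−1}` with `π_i < π_{i+1}`. -/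
def oascB {n : ℕ} (w : BG n) : ℕ :=
  ((range n).filter fun i => Odd i ∧ bval w i < bval w (i + 1)).card

/-- type B inversion number -/
def invB {n : ℕ} (w : BG n) : ℕ :=
  ((Icc 1 n ×ˢ Icc 1 n).filter fun p => p.1 < p.2 ∧ bval w p.2 < bval w p.1).card
  + ((Icc 1 n ×ˢ Icc 1 n).filter fun p => p.1 < p.2 ∧ bval w p.2 < -bval w p.1).card
  + ((Icc 1 n).filter fun i => bval w i < 0).card

/-- `B_n(s,t,q)` -/
noncomputable def Bpoly {A : Type*} [CommRing A] (n : ℕ) (s t q : A) : A :=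
  ∑ w : BG n, s ^ edesB w * t ^ odesB w * q ^ invB w

/-- `B_n(1,q)` -/
noncomputable def BOne {A : Type*} [CommRing A] (n : ℕ) (q : A) : A :=
  ∑ w : BG n, q ^ invB w

/-- `[k]_q` -/
def qInt {A : Type*} [CommRing A] (k : ℕ) (q : A) : A := ∑ i ∈ range k, q ^ i

/-- `[k]_q!` -/
def qFact {A : Type*} [CommRing A] (k : ℕ) (q : A) : A := ∏ i ∈ range k, qInt (i + 1) q

/-- number of negative values `π_1,…,π_n` -/
def negs {n : ℕ} (w : BG n) : ℕ := ((Icc 1 n).filter fun i => bval w i < 0).card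

/-- the type D group `𝔇_n` inside `𝔅_n` -/
def DG (n : ℕ) : Finset (BG n) := univ.filter fun w => Even (negs w)

/-- `odes_D`: odd `i ∈ {−1,1,…,n−1}` with `π_i > π_{|i|+1}` (the index `i = −1`
contributes iff `−π_1 > π_2`). -/
def odesD {n : ℕ} (w : BG n) : ℕ :=
  ((Icc 1 (n - 1)).filter fun i => Odd i ∧ bval w (i + 1) < bval w i).card
  + (if bval w 2 < -bval w 1 then 1 else 0)

/-- `edes_D`: even `i ∈ {−1,1,…,n−1}` with `π_i > π_{i+1}`. -/
def edesD {n : ℕ} (w : BG n) : ℕ :=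
  ((Icc 1 (n - 1)).filter fun i => Even i ∧ bval w (i + 1) < bval w i).card

/-- type D inversion number -/
def invD {n : ℕ} (w : BG n) : ℕ :=
  ((Icc 1 n ×ˢ Icc 1 n).filter fun p => p.1 < p.2 ∧ bval w p.2 < bval w p.1).card
  + ((Icc 1 n ×ˢ Icc 1 n).filter fun p => p.1 < p.2 ∧ bval w p.2 < -bval w p.1).card

/-- `D_n(s,t,q)` -/
noncomputable def Dpoly {A : Type*} [CommRing A] (n : ℕ) (s t q : A) : A :=
  ∑ w ∈ DG n, s ^ edesD w * t ^ odesD w * q ^ invD w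

/-- `D_n(1,q)` -/
noncomputable def DOne {A : Type*} [CommRing A] (n : ℕ) (q : A) : A :=
  ∑ w ∈ DG n, q ^ invD w

noncomputable section

/-- the field `ℚ(q,s,t)` -/
abbrev K : Type := FractionRing (MvPolynomial (Fin 3) ℚ)

def qK : K := algebraMap (MvPolynomial (Fin 3) ℚ) K (MvPolynomial.X 0)
def sK : K := algebraMap (MvPolynomial (Fin 3) ℚ) K (MvPolynomial.X 1)
def tK : K := algebraMap (MvPolynomial (Fin 3) ℚ) K (MvPolynomial.X 2)

/-- the ring `R = ℚ(q,s,t)[M]/(M² − (1−s)(1−t))` -/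
abbrev R : Type := AdjoinRoot ((Polynomial.X : Polynomial K) ^ 2
  - Polynomial.C ((1 - sK) * (1 - tK)))

/-- the square root `M` of `(1−s)(1−t)` -/
def M : R := AdjoinRoot.root _

def ofK : K →+* R := algebraMap K R

/-- The value `π_{i+1}`, indexed by `i : Fin n`. -/
def signedVal {n : ℕ} (w : BG n) (i : Fin n) : ℤ :=
  (if w.2 i then -1 else 1) * (((w.1 i : Fin n) : ℕ) + 1 : ℤ)

lemma bval_succ {n : ℕ} (w : BG n) (i : Fin n) : bval w (i + 1) = signedVal w i := by
  have h : 1 ≤ (i : ℕ) + 1 ∧ (i : ℕ) + 1 ≤ n := by omega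
  simp [bval, signedVal, h]

lemma signedVal_injective {n : ℕ} (w : BG n) : Function.Injective (signedVal w) := by
  intro i j h
  apply w.1.injective
  apply Fin.ext
  unfold signedVal at h
  split_ifs at h <;> omega

/-- The number of inversions of a word. -/
def invCount {n : ℕ} (v : Fin n → ℤ) : ℕ :=
  (univ.filter fun p : Fin n × Fin n => p.1 < p.2 ∧ v p.2 < v p.1).card

/-- The number of pairs of positions of a word with negative sum. -/
def negSumPairs {n : ℕ} (v : Fin n → ℤ) : ℕ :=
  (univ.filter fun p : Fin n × Fin n => p.1 < p.2 ∧ v p.2 < -v p.1).card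

lemma card_filter_Icc_product (n : ℕ) (P : ℕ × ℕ → Prop) [DecidablePred P] :
    ((Icc 1 n ×ˢ Icc 1 n).filter P).card
      = (univ.filter fun p : Fin n × Fin n => P (p.1 + 1, p.2 + 1)).card := by
  symm
  refine Finset.card_bij (fun p _ => ((p.1 : ℕ) + 1, (p.2 : ℕ) + 1)) ?_ ?_ ?_
  · intro p hp
    simp only [mem_filter, mem_univ, true_and, mem_product, mem_Icc] at hp ⊢
    exact ⟨by omega, hp⟩
  · rintro ⟨a, b⟩ _ ⟨c, d⟩ _ h
    simp only [Prod.mk.injEq] at h ⊢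
    exact ⟨Fin.ext (by omega), Fin.ext (by omega)⟩
  · rintro ⟨a, b⟩ h
    simp only [mem_filter, mem_product, mem_Icc] at h
    obtain ⟨⟨⟨ha, ha'⟩, hb, hb'⟩, hP⟩ := h
    refine ⟨(⟨a - 1, by omega⟩, ⟨b - 1, by omega⟩), ?_, ?_⟩
    · simpa [Nat.sub_add_cancel ha, Nat.sub_add_cancel hb] using hP
    · simp [Nat.sub_add_cancel ha, Nat.sub_add_cancel hb]

lemma invD_eq {n : ℕ} (w : BG n) :
    invD w = invCount (signedVal w) + negSumPairs (signedVal w) := by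
  simp only [invD, card_filter_Icc_product, invCount, negSumPairs, bval_succ,
    add_lt_add_iff_right, Fin.val_fin_lt]

lemma negs_eq {n : ℕ} (w : BG n) : negs w = (univ.filter fun i => w.2 i = true).card := by
  symm
  have hneg : ∀ i : Fin n, signedVal w i < 0 ↔ w.2 i = true := by
    intro i
    unfold signedVal
    split_ifs with h <;> simp [h] <;> omega
  refine Finset.card_bij (fun i _ => (i : ℕ) + 1) ?_ ?_ ?_
  · intro i hi
    simp only [mem_filter, mem_univ, true_and, mem_Icc] at hi ⊢
    exact ⟨by omega, by rw [bval_succ, hneg]; exact hi⟩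
  · intro i _ j _ h
    exact Fin.ext (by omega)
  · intro a h
    simp only [mem_filter, mem_Icc] at h
    obtain ⟨⟨ha, ha'⟩, hP⟩ := h
    refine ⟨⟨a - 1, by omega⟩, ?_, Nat.sub_add_cancel ha⟩
    simp only [mem_filter, mem_univ, true_and, ← hneg, ← bval_succ]
    rwa [Nat.sub_add_cancel ha]

/-- Rearranging the positions of a signed permutation. -/
def rearrange {n : ℕ} (w : BG n) (τ : Equiv.Perm (Fin n)) : BG n := (τ.trans w.1, w.2 ∘ τ)

lemma signedVal_rearrange {n : ℕ} (w : BG n) (τ : Equiv.Perm (Fin n)) (i : Fin n) :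
    signedVal (rearrange w τ) i = signedVal w (τ i) := rfl

lemma rearrange_injective {n : ℕ} (τ : Equiv.Perm (Fin n)) :
    Function.Injective fun w : BG n => rearrange w τ := by
  intro w w' h
  simp only [rearrange, Prod.mk.injEq] at h
  refine Prod.ext ?_ ?_
  · ext i
    have := congrArg (fun e : Equiv.Perm (Fin n) => e (τ.symm i)) h.1
    simpa using congrArg Fin.val this
  · funext i
    simpa using congrFun h.2 (τ.symm i)

lemma rearrange_symm_rearrange {n : ℕ} (w : BG n) (τ : Equiv.Perm (Fin n)) :
    rearrange (rearrange w τ.symm) τ = w := by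
  refine Prod.ext ?_ ?_
  · ext i; simp [rearrange]
  · funext i; simp [rearrange]

lemma negs_rearrange {n : ℕ} (w : BG n) (τ : Equiv.Perm (Fin n)) :
    negs (rearrange w τ) = negs w := by
  rw [negs_eq, negs_eq]
  refine Finset.card_bij (fun i _ => τ i) ?_ ?_ ?_
  · intro i hi
    rw [mem_filter] at hi ⊢
    exact ⟨mem_univ _, hi.2⟩
  · intro i _ j _ h
    exact τ.injective h
  · intro j hj
    exact ⟨τ.symm j, by rw [mem_filter] at hj ⊢; simpa [rearrange] using hj.2, by simp⟩

lemma rearrange_mem_DG {n : ℕ} (w : BG n) (τ : Equiv.Perm (Fin n)) :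
    rearrange w τ ∈ DG n ↔ w ∈ DG n := by
  simp [DG, negs_rearrange]

lemma two_mul_negSumPairs {n : ℕ} (v : Fin n → ℤ) :
    2 * negSumPairs v
      = (univ.filter fun p : Fin n × Fin n => p.1 ≠ p.2 ∧ v p.2 < -v p.1).card := by
  have hsplit : (univ.filter fun p : Fin n × Fin n => p.1 ≠ p.2 ∧ v p.2 < -v p.1)
      = (univ.filter fun p : Fin n × Fin n => p.1 < p.2 ∧ v p.2 < -v p.1)
        ∪ (univ.filter fun p : Fin n × Fin n => p.2 < p.1 ∧ v p.2 < -v p.1) := by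
    ext p
    simp only [mem_filter, mem_univ, true_and, mem_union, ne_iff_lt_or_gt]
    tauto
  have hswap : (univ.filter fun p : Fin n × Fin n => p.2 < p.1 ∧ v p.2 < -v p.1).card
      = negSumPairs v := by
    refine Finset.card_bij (fun p _ => p.swap) ?_ ?_ ?_
    · intro p hp
      simp only [mem_filter, mem_univ, true_and, Prod.fst_swap, Prod.snd_swap] at hp ⊢
      exact ⟨hp.1, by linarith [hp.2]⟩
    · intro p _ p' _ h
      exact Prod.swap_injective h
    · intro p hp
      simp only [mem_filter, mem_univ, true_and] at hp
      exact ⟨p.swap, by simpa using ⟨hp.1, by linarith [hp.2]⟩, by simp⟩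
  rw [hsplit, card_union_of_disjoint, hswap, two_mul, negSumPairs]
  rw [disjoint_filter]
  intro p _ h h'
  exact lt_asymm h.1 h'.1

lemma negSumPairs_comp_perm {n : ℕ} (v : Fin n → ℤ) (τ : Equiv.Perm (Fin n)) :
    negSumPairs (v ∘ τ) = negSumPairs v := by
  refine Nat.eq_of_mul_eq_mul_left two_pos ?_
  rw [two_mul_negSumPairs, two_mul_negSumPairs]
  refine Finset.card_bij (fun p _ => (τ p.1, τ p.2)) ?_ ?_ ?_
  · intro p hp
    simpa using hp
  · intro p _ p' _ h
    simp only [Prod.mk.injEq, EmbeddingLike.apply_eq_iff_eq] at h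
    exact Prod.ext h.1 h.2
  · intro p hp
    refine ⟨(τ.symm p.1, τ.symm p.2), by simpa using hp, by simp⟩

/-- The cycle sending `p` to `r` and each `i ∈ (p, r]` to `i - 1`. -/
def blockCycle {n : ℕ} {p r : Fin n} (h : p ≤ r) : Equiv.Perm (Fin n) where
  toFun i := if i = p then r
    else if p < i ∧ i ≤ r then ⟨i - 1, by omega⟩ else i
  invFun i := if i = r then p
    else if hi : p ≤ i ∧ i < r then ⟨i + 1, by omega⟩ else i
  left_inv i := by
    simp only [Fin.ext_iff, Fin.lt_def, Fin.le_def] at *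
    split_ifs <;> simp_all <;> omega
  right_inv i := by
    simp only [Fin.ext_iff, Fin.lt_def, Fin.le_def] at *
    split_ifs <;> simp_all <;> omega

lemma val_blockCycle {n : ℕ} {p r : Fin n} (h : p ≤ r) (i : Fin n) :
    (blockCycle h i : ℕ) = if (i : ℕ) = p then (r : ℕ)
      else if (p : ℕ) < i ∧ (i : ℕ) ≤ r then (i : ℕ) - 1 else i := by
  simp only [blockCycle, Equiv.coe_fn_mk, Fin.ext_iff, Fin.lt_def, Fin.le_def]
  split_ifs <;> rfl

lemma val_blockCycle_symm {n : ℕ} {p r : Fin n} (h : p ≤ r) (i : Fin n) :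
    ((blockCycle h).symm i : ℕ) = if (i : ℕ) = r then (p : ℕ)
      else if (p : ℕ) ≤ i ∧ (i : ℕ) < r then (i : ℕ) + 1 else i := by
  simp only [blockCycle, Equiv.coe_fn_symm_mk, Fin.ext_iff, Fin.lt_def, Fin.le_def]
  split_ifs <;> rfl

/-- The word is increasing on the positions from `p` on. -/
def IncreasingFrom {n : ℕ} (p : ℕ) (v : Fin n → ℤ) : Prop :=
  ∀ i j : Fin n, p ≤ i → i < j → v i < v j

lemma invCount_comp_blockCycle {n : ℕ} {p r : Fin n} (h : p ≤ r) {v : Fin n → ℤ}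
    (hv : IncreasingFrom p v) :
    invCount (v ∘ blockCycle h) = invCount v + (r - p : ℕ) := by
  have hre : invCount (v ∘ blockCycle h) = (univ.filter fun x : Fin n × Fin n =>
      (blockCycle h).symm x.1 < (blockCycle h).symm x.2 ∧ v x.2 < v x.1).card := by
    refine Finset.card_bij (fun x _ => (blockCycle h x.1, blockCycle h x.2)) ?_ ?_ ?_
    · intro x hx
      simpa using hx
    · intro x _ x' _ hx
      simp only [Prod.mk.injEq, EmbeddingLike.apply_eq_iff_eq] at hx
      exact Prod.ext hx.1 hx.2
    · intro x hx
      exact ⟨((blockCycle h).symm x.1, (blockCycle h).symm x.2), by simpa using hx, by simp⟩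
  have hsplit : (univ.filter fun x : Fin n × Fin n =>
      (blockCycle h).symm x.1 < (blockCycle h).symm x.2 ∧ v x.2 < v x.1)
      = (univ.filter fun x : Fin n × Fin n => x.1 < x.2 ∧ v x.2 < v x.1)
        ∪ (Ico p r).map ⟨fun b => (r, b), Prod.mk_right_injective r⟩ := by
    ext ⟨a, b⟩
    have hab := hv a b
    have hba := hv b a
    simp only [mem_filter, mem_univ, true_and, mem_union, mem_map, mem_Ico,
      Function.Embedding.coeFn_mk, Prod.mk.injEq, Fin.lt_def, val_blockCycle_symm]
    simp only [Fin.lt_def] at hab hba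
    have hex : (∃ c, (p ≤ c ∧ (c : ℕ) < r) ∧ r = a ∧ c = b)
        ↔ (p : ℕ) ≤ b ∧ (b : ℕ) < r ∧ (r : ℕ) = a := by
      constructor
      · rintro ⟨c, ⟨h1, h2⟩, h3, rfl⟩
        exact ⟨h1, h2, congrArg _ h3⟩
      · rintro ⟨h1, h2, h3⟩
        exact ⟨b, ⟨h1, h2⟩, Fin.ext h3, rfl⟩
    rw [hex]
    have h' : (p : ℕ) ≤ r := h
    constructor
    · rintro ⟨h1, h2⟩
      have := fun x y => lt_asymm h2 (hab x y)
      split_ifs at h1 <;> omega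
    · rintro (⟨h1, h2⟩ | ⟨h1, h2, h3⟩)
      · have := fun x => lt_asymm h2 (hab x h1)
        refine ⟨?_, h2⟩
        split_ifs <;> omega
      · refine ⟨?_, hba h1 (by omega)⟩
        split_ifs <;> omega
  rw [hre, hsplit, card_union_of_disjoint, card_map, Fin.card_Ico, invCount]
  rw [disjoint_left]
  rintro ⟨a, b⟩ h1 h2
  simp only [mem_filter, mem_univ, true_and, mem_map, mem_Ico,
    Function.Embedding.coeFn_mk, Prod.mk.injEq] at h1 h2
  obtain ⟨c, hc, rfl, rfl⟩ := h2
  exact lt_asymm hc.2 h1.1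

lemma invD_rearrange_blockCycle {n : ℕ} {p r : Fin n} (h : p ≤ r) {w : BG n}
    (hw : IncreasingFrom p (signedVal w)) :
    invD (rearrange w (blockCycle h)) = invD w + (r - p : ℕ) := by
  have hval : signedVal (rearrange w (blockCycle h)) = signedVal w ∘ blockCycle h := rfl
  rw [invD_eq, invD_eq, hval, invCount_comp_blockCycle h hw, negSumPairs_comp_perm]
  omega

open Classical in
/-- The elements of `𝔇_n` that increase from position `p` (counted from zero) on. -/
def increasingDG (n p : ℕ) : Finset (BG n) :=
  (DG n).filter fun w => IncreasingFrom p (signedVal w)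

lemma mem_increasingDG {n p : ℕ} {w : BG n} :
    w ∈ increasingDG n p ↔ w ∈ DG n ∧ IncreasingFrom p (signedVal w) := by
  simp [increasingDG]

lemma lt_iff_le_of_rearrange {n : ℕ} {p r : Fin n} (h : p ≤ r) {w : BG n}
    (hw : IncreasingFrom p (signedVal w)) {i : Fin n} (hi : p < i) :
    signedVal (rearrange w (blockCycle h)) i < signedVal (rearrange w (blockCycle h)) p
      ↔ i ≤ r := by
  have hp := val_blockCycle h p
  have hc := val_blockCycle h i
  have h' : (p : ℕ) ≤ r := h
  have hi' : (p : ℕ) < i := hi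
  rw [if_pos rfl] at hp
  rw [if_neg (by omega)] at hc
  rw [signedVal_rearrange, signedVal_rearrange]
  constructor
  · intro hlt
    by_contra hle
    have hle' : ¬ (i : ℕ) ≤ r := hle
    rw [if_neg (by omega)] at hc
    refine lt_asymm hlt (hw _ _ (by omega) ?_)
    rw [Fin.lt_def]
    omega
  · intro hle
    have hle' : (i : ℕ) ≤ r := hle
    rw [if_pos ⟨hi', hle'⟩] at hc
    refine hw _ _ (by omega) ?_
    rw [Fin.lt_def]
    omega

lemma exists_insertion_point {n : ℕ} (p : Fin n) {v : Fin n → ℤ}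
    (hv : IncreasingFrom (p + 1) v) :
    ∃ r, p ≤ r ∧ ∀ i, p < i → (v i < v p ↔ i ≤ r) := by
  obtain ⟨r, hr, hmax⟩ := (univ.filter fun i => i = p ∨ (p < i ∧ v i < v p)).exists_max_image id
    ⟨p, by simp⟩
  simp only [mem_filter, mem_univ, true_and, id] at hr hmax
  refine ⟨r, hmax p (Or.inl rfl), fun i hi => ⟨fun h => hmax i (Or.inr ⟨hi, h⟩), fun h => ?_⟩⟩
  rcases hr with rfl | ⟨h1, h2⟩
  · exact absurd hi (not_lt.mpr h)
  · rcases h.eq_or_lt with rfl | hlt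
    · exact h2
    · exact (hv i r hi hlt).trans h2

lemma increasingFrom_rearrange_symm {n : ℕ} {p r : Fin n} (h : p ≤ r) {w : BG n}
    (hw : IncreasingFrom (p + 1) (signedVal w))
    (hr : ∀ i, p < i → (signedVal w i < signedVal w p ↔ i ≤ r)) :
    IncreasingFrom p (signedVal (rearrange w (blockCycle h).symm)) := by
  intro i j hi hij
  have hci := val_blockCycle_symm h i
  have hcj := val_blockCycle_symm h j
  have h' : (p : ℕ) ≤ r := h
  have hij' : (i : ℕ) < j := hij
  rw [signedVal_rearrange, signedVal_rearrange]
  generalize (blockCycle h).symm i = a at *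
  generalize (blockCycle h).symm j = b at *
  by_cases hir : (i : ℕ) = r
  · rw [if_pos hir] at hci
    obtain rfl : a = p := Fin.ext hci
    rw [if_neg (by omega), if_neg (by omega)] at hcj
    have hb : a < b := by rw [Fin.lt_def]; omega
    have hne : signedVal w b ≠ signedVal w a := fun e => hb.ne' (signedVal_injective w e)
    have := mt (hr b hb).1 (by rw [Fin.le_def]; omega)
    omega
  · rw [if_neg hir] at hci
    by_cases hjr : (j : ℕ) = r
    · rw [if_pos hjr] at hcj
      obtain rfl : b = p := Fin.ext hcj
      rw [if_pos (by omega)] at hci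
      exact (hr a (by rw [Fin.lt_def]; omega)).2 (by rw [Fin.le_def]; omega)
    · rw [if_neg hjr] at hcj
      refine hw a b ?_ ?_
      · split_ifs at hci <;> omega
      · rw [Fin.lt_def]
        split_ifs at hci hcj <;> omega

lemma sum_increasingDG_succ {A : Type*} [CommRing A] (q : A) {n : ℕ} (p : Fin n) :
    ∑ w ∈ increasingDG n (p + 1), q ^ invD w
      = (∑ w ∈ increasingDG n p, q ^ invD w) * qInt (n - p) q := by
  have hq : qInt (n - p) q = ∑ r ∈ (Ici p).attach, q ^ ((r.1 : ℕ) - p) := by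
    rw [qInt, Finset.sum_attach (Ici p) fun r : Fin n => q ^ ((r : ℕ) - p)]
    symm
    refine Finset.sum_bij (fun r _ => (r : ℕ) - p) ?_ ?_ ?_ fun _ _ => rfl
    · intro r hr
      rw [mem_Ici, Fin.le_def] at hr
      rw [mem_range]
      omega
    · intro r hr r' hr' e
      rw [mem_Ici, Fin.le_def] at hr hr'
      exact Fin.ext (by omega)
    · intro k hk
      rw [mem_range] at hk
      exact ⟨⟨p + k, by omega⟩, by rw [mem_Ici, Fin.le_def]; simp, by simp⟩
  rw [hq, Finset.sum_mul_sum, ← Finset.sum_product']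
  symm
  refine Finset.sum_bij
    (fun x _ => rearrange x.1 (blockCycle (mem_Ici.1 x.2.2))) ?_ ?_ ?_ ?_
  · rintro ⟨w, r, hr⟩ hx
    have hr' : p ≤ r := mem_Ici.1 hr
    rw [Fin.le_def] at hr'
    simp only [mem_product, mem_increasingDG, mem_attach, and_true] at hx
    rw [mem_increasingDG, rearrange_mem_DG]
    refine ⟨hx.1, fun i j hi hij => ?_⟩
    have hij' : (i : ℕ) < j := hij
    refine hx.2 _ _ ?_ ?_
    · rw [val_blockCycle]
      split_ifs <;> omega
    · rw [Fin.lt_def, val_blockCycle, val_blockCycle]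
      split_ifs <;> omega
  · rintro ⟨w, r, hr⟩ hx ⟨w', r', hr'⟩ hx' e
    simp only [mem_product, mem_increasingDG, mem_attach, and_true] at hx hx' e
    have hiff : ∀ i, p < i → (i ≤ r ↔ i ≤ r') := fun i hi => by
      rw [← lt_iff_le_of_rearrange (mem_Ici.1 hr) hx.2 hi, e,
        lt_iff_le_of_rearrange (mem_Ici.1 hr') hx'.2 hi]
    have hrr : r = r' := by
      rw [mem_Ici] at hr hr'
      rcases lt_trichotomy r r' with hlt | heq | hlt
      · exact absurd ((hiff r' (hr.trans_lt hlt)).2 le_rfl) (not_le.2 hlt)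
      · exact heq
      · exact absurd ((hiff r (hr'.trans_lt hlt)).1 le_rfl) (not_le.2 hlt)
    subst hrr
    obtain rfl := rearrange_injective _ e
    rfl
  · intro w hw
    rw [mem_increasingDG] at hw
    obtain ⟨r, hpr, hr⟩ := exists_insertion_point p hw.2
    refine ⟨(rearrange w (blockCycle hpr).symm, ⟨r, mem_Ici.2 hpr⟩), ?_,
      rearrange_symm_rearrange _ _⟩
    simp only [mem_product, mem_increasingDG, mem_attach, and_true, rearrange_mem_DG]
    exact ⟨hw.1, increasingFrom_rearrange_symm hpr hw.2 hr⟩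
  · rintro ⟨w, r, hr⟩ hx
    simp only [mem_product, mem_increasingDG, mem_attach, and_true] at hx
    rw [invD_rearrange_blockCycle _ hx.2, pow_add]

lemma sum_increasingDG_mul_qFact {A : Type*} [CommRing A] (q : A) {n : ℕ} (k : ℕ) (hk : k ≤ n) :
    (∑ w ∈ increasingDG n (n - k), q ^ invD w) * qFact k q = DOne n q := by
  induction k with
  | zero =>
    have : increasingDG n n = DG n := by
      ext w
      rw [mem_increasingDG]
      exact and_iff_left fun i _ hi => absurd hi (by omega)
    simp [qFact, DOne, this]
  | succ k ih =>
    have hstep := sum_increasingDG_succ q (⟨n - (k + 1), by omega⟩ : Fin n)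
    simp only [show n - (k + 1) + 1 = n - k by omega,
      show n - (n - (k + 1)) = k + 1 by omega] at hstep
    rw [← ih (by omega), hstep, qFact, Finset.prod_range_succ, qFact]
    ring

lemma increasingFrom_one_iff {n : ℕ} (w : BG n) :
    (∀ j : ℕ, j < n → 2 ≤ j → bval w j < bval w (j + 1))
      ↔ IncreasingFrom 1 (signedVal w) := by
  constructor
  · intro h i j hi hij
    have hij' : (i : ℕ) < j := hij
    rw [← bval_succ, ← bval_succ]
    have key : ∀ m : ℕ, (i : ℕ) + 1 ≤ m → m < n → bval w (i + 1) < bval w (m + 1) := by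
      intro m hm
      induction m, hm using Nat.le_induction with
      | base => exact fun hlt => h _ hlt (by omega)
      | succ m hm ih => exact fun hlt => (ih (by omega)).trans (h _ hlt (by omega))
    exact key j hij' j.isLt
  · intro h j hj h2
    have := h ⟨j - 1, by omega⟩ ⟨j, hj⟩ (by simp; omega) (by rw [Fin.lt_def]; simp; omega)
    rw [← bval_succ, ← bval_succ] at this
    simpa [Nat.sub_add_cancel (show 1 ≤ j by omega)] using this

lemma bval_one {n : ℕ} (h : 0 < n) (w : BG n) : bval w 1 = signedVal w ⟨0, h⟩ :=
  bval_succ w ⟨0, h⟩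

lemma bval_two {n : ℕ} (h : 1 < n) (w : BG n) : bval w 2 = signedVal w ⟨1, h⟩ :=
  bval_succ w ⟨1, h⟩

lemma edesD_eq_zero {n : ℕ} {w : BG n}
    (h : ∀ j : ℕ, j < n → 2 ≤ j → bval w j < bval w (j + 1)) : edesD w = 0 := by
  rw [edesD, card_eq_zero, filter_eq_empty_iff]
  rintro j hj ⟨⟨k, hk⟩, hlt⟩
  rw [mem_Icc] at hj
  exact lt_asymm hlt (h j (by omega) (by omega))

lemma odesD_eq {n : ℕ} (hn : 2 ≤ n) {w : BG n}
    (h : ∀ j : ℕ, j < n → 2 ≤ j → bval w j < bval w (j + 1)) :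
    odesD w = (if bval w 2 < bval w 1 then 1 else 0)
      + (if bval w 2 < -bval w 1 then 1 else 0) := by
  rw [odesD]
  congr 1
  have : (Icc 1 (n - 1)).filter (fun i => Odd i ∧ bval w (i + 1) < bval w i)
      = ({1} : Finset ℕ).filter fun i => bval w (i + 1) < bval w i := by
    ext j
    simp only [mem_filter, mem_Icc, mem_singleton]
    constructor
    · rintro ⟨hj, _, hlt⟩
      refine ⟨?_, hlt⟩
      by_contra hne
      exact lt_asymm hlt (h j (by omega) (by omega))
    · rintro ⟨rfl, hlt⟩
      exact ⟨⟨le_rfl, by omega⟩, odd_one, hlt⟩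
  rw [this, filter_singleton, apply_ite Finset.card]
  simp

/-- Conjugation by the sign change of the first letter: it flips the sign in the given position `z`
and the sign of the value `±(z + 1)`. -/
def signConj {n : ℕ} (z : Fin n) (w : BG n) : BG n :=
  (w.1, fun i => xor (w.2 i) (xor (decide (w.1 i = z)) (decide (i = z))))

lemma signConj_snd {n : ℕ} (z : Fin n) (w : BG n) (i : Fin n) :
    (signConj z w).2 i = xor (w.2 i) (xor (decide (w.1 i = z)) (decide (i = z))) := rfl

lemma signConj_signConj {n : ℕ} (z : Fin n) (w : BG n) : signConj z (signConj z w) = w := by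
  refine Prod.ext rfl (funext fun i => ?_)
  change xor (xor (w.2 i) (xor (decide (w.1 i = z)) (decide (i = z))))
    (xor (decide (w.1 i = z)) (decide (i = z))) = w.2 i
  rw [Bool.xor_assoc, Bool.xor_self, Bool.xor_false]

lemma ite_xor_neg_one (a b c : Bool) :
    (if xor a (xor b c) then (-1 : ℤ) else 1)
      = (if a then -1 else 1) * ((if b then -1 else 1) * (if c then -1 else 1)) := by
  cases a <;> cases b <;> cases c <;> rfl

lemma sign_signConj {n : ℕ} (z : Fin n) (w : BG n) (i : Fin n) :
    (if (signConj z w).2 i then (-1 : ℤ) else 1)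
      = (if w.2 i then -1 else 1) * ((if w.1 i = z then -1 else 1) * (if i = z then -1 else 1)) := by
  rw [signConj_snd, ite_xor_neg_one]
  simp only [decide_eq_true_eq]

lemma signedVal_signConj {n : ℕ} (z : Fin n) (w : BG n) (i : Fin n) :
    signedVal (signConj z w) i
      = (if i = z then -1 else 1) * ((if w.1 i = z then -1 else 1) * signedVal w i) := by
  rw [signedVal, signedVal, sign_signConj]
  simp only [signConj]
  ring

lemma neg_one_pow_negs {n : ℕ} (w : BG n) :
    (-1 : ℤ) ^ negs w = ∏ i, if w.2 i then -1 else 1 := by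
  rw [negs_eq, Finset.prod_ite]
  simp

lemma signConj_mem_DG {n : ℕ} (z : Fin n) (w : BG n) : signConj z w ∈ DG n ↔ w ∈ DG n := by
  have hpow : (-1 : ℤ) ^ negs (signConj z w) = (-1) ^ negs w := by
    have hterm : ∀ i, w.1 i = z ↔ i = w.1.symm z := fun i => (Equiv.eq_symm_apply _).symm
    simp only [neg_one_pow_negs, sign_signConj, Finset.prod_mul_distrib, hterm]
    simp
  simp only [DG, mem_filter, mem_univ, true_and, ← neg_one_pow_eq_one_iff_even
    (show (-1 : ℤ) ≠ 1 by decide), hpow]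

lemma signedVal_signConj_lt_iff {n : ℕ} {z : Fin n} (hz : (z : ℕ) = 0) (w : BG n) {i j : Fin n}
    (hij : i ≠ j) (hj : j ≠ z) :
    (signedVal (signConj z w) j < signedVal (signConj z w) i ↔
        if i = z then signedVal w j < -signedVal w i else signedVal w j < signedVal w i) ∧
      (signedVal (signConj z w) j < -signedVal (signConj z w) i ↔
        if i = z then signedVal w j < signedVal w i else signedVal w j < -signedVal w i) := by
  have hne : (w.1 i : ℕ) ≠ w.1 j := fun h => hij (w.1.injective (Fin.ext h))
  rw [signedVal_signConj, signedVal_signConj, if_neg hj]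
  have hval : ∀ a : Fin n, a = z ↔ (a : ℕ) = 0 := fun a => by rw [Fin.ext_iff, hz]
  simp only [hval (w.1 i), hval (w.1 j), signedVal]
  generalize (w.1 i : ℕ) = x at *
  generalize (w.1 j : ℕ) = y at *
  by_cases hi : i = z
  · simp only [if_pos hi]
    split_ifs <;> omega
  · simp only [if_neg hi]
    split_ifs <;> omega

lemma invD_signConj {n : ℕ} {z : Fin n} (hz : (z : ℕ) = 0) (w : BG n) :
    invD (signConj z w) = invD w := by
  simp only [invD_eq, invCount, negSumPairs, card_filter, ← sum_add_distrib]
  refine Finset.sum_congr rfl fun p _ => ?_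
  by_cases hp : p.1 < p.2
  · have h := signedVal_signConj_lt_iff hz w hp.ne
      (by rw [Ne, Fin.ext_iff]; rw [Fin.lt_def] at hp; omega)
    simp only [hp, true_and, h.1, h.2]
    split_ifs <;> omega
  · simp [hp]

lemma increasingFrom_one_signConj {n : ℕ} {z : Fin n} (hz : (z : ℕ) = 0) {w : BG n}
    (hw : IncreasingFrom 1 (signedVal w)) : IncreasingFrom 1 (signedVal (signConj z w)) := by
  intro i j hi hij
  have hij' : (i : ℕ) < j := hij
  have hne : ∀ a : Fin n, 0 < (a : ℕ) → a ≠ z := fun a ha h => by rw [h] at ha; omega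
  have h := (signedVal_signConj_lt_iff hz w hij.ne' (hne i hi)).1
  rw [if_neg (hne j (by omega))] at h
  exact h.2 (hw i j hi hij)

lemma increasingFrom_zero_iff {n : ℕ} (hn : 1 < n) (w : BG n) :
    IncreasingFrom 0 (signedVal w)
      ↔ IncreasingFrom 1 (signedVal w) ∧ ¬ bval w 2 < bval w 1 := by
  rw [bval_one (by omega), bval_two hn]
  constructor
  · intro h
    exact ⟨fun i j _ hij => h i j (Nat.zero_le _) hij,
      not_lt.2 (h _ _ (Nat.zero_le _) (by simp [Fin.lt_def])).le⟩
  · rintro ⟨h, hle⟩ i j _ hij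
    by_cases hi : 1 ≤ (i : ℕ)
    · exact h i j hi hij
    have hij' : (i : ℕ) < j := hij
    obtain rfl : i = ⟨0, Nat.zero_lt_of_lt hn⟩ := Fin.ext (by simp; omega)
    have hlt := (not_lt.1 hle).lt_of_ne fun e => by simpa using signedVal_injective w e
    by_cases hj : (j : ℕ) = 1
    · obtain rfl : j = ⟨1, hn⟩ := Fin.ext hj
      exact hlt
    · exact hlt.trans (h _ _ le_rfl (by rw [Fin.lt_def]; simp only; omega))

lemma filter_increasingDG_one {n : ℕ} (hn : 1 < n) :
    (increasingDG n 1).filter (fun w => ¬ bval w 2 < bval w 1) = increasingDG n 0 := by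
  ext w
  rw [mem_filter, mem_increasingDG, mem_increasingDG, increasingFrom_zero_iff hn, and_assoc]

lemma sum_filter_increasingDG_one_neg {A : Type*} [CommRing A] (q : A) {n : ℕ} (hn : 1 < n) :
    ∑ w ∈ (increasingDG n 1).filter (fun w => ¬ bval w 2 < -bval w 1), q ^ invD w
      = ∑ w ∈ increasingDG n 0, q ^ invD w := by
  rw [← filter_increasingDG_one hn]
  have hlt := fun w : BG n => signedVal_signConj_lt_iff (z := ⟨0, by omega⟩) rfl w
    (i := ⟨0, by omega⟩) (j := ⟨1, hn⟩) (by simp) (by simp)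
  simp only [if_true, ← bval_one, ← bval_two] at hlt
  refine Finset.sum_nbij' (signConj ⟨0, by omega⟩) (signConj ⟨0, by omega⟩) ?_ ?_
    (fun w _ => signConj_signConj _ w) (fun w _ => signConj_signConj _ w)
    (fun w _ => by rw [invD_signConj rfl])
  · intro w hw
    rw [mem_filter, mem_increasingDG] at hw ⊢
    rw [signConj_mem_DG, (hlt w).1]
    exact ⟨⟨hw.1.1, increasingFrom_one_signConj rfl hw.1.2⟩, hw.2⟩
  · intro w hw
    rw [mem_filter, mem_increasingDG] at hw ⊢
    rw [signConj_mem_DG, (hlt w).2]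
    exact ⟨⟨hw.1.1, increasingFrom_one_signConj rfl hw.1.2⟩, hw.2⟩

/-- The identity signed permutation. -/
def identityBG (n : ℕ) : BG n := (1, fun _ => false)

lemma signedVal_identityBG {n : ℕ} (i : Fin n) : signedVal (identityBG n) i = i + 1 := by
  simp [signedVal, identityBG]

lemma invD_identityBG (n : ℕ) : invD (identityBG n) = 0 := by
  simp only [invD_eq, invCount, negSumPairs, signedVal_identityBG, Nat.add_eq_zero_iff,
    card_eq_zero, filter_eq_empty_iff, Fin.lt_def]
  constructor <;> rintro p _ ⟨h1, h2⟩ <;> omega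

lemma filter_increasingDG_one_both {n : ℕ} (hn : 1 < n) :
    (increasingDG n 1).filter (fun w => ¬ bval w 2 < bval w 1 ∧ ¬ bval w 2 < -bval w 1)
      = {identityBG n} := by
  ext w
  rw [mem_filter, mem_increasingDG, mem_singleton, ← and_assoc, and_assoc (a := w ∈ DG n),
    ← increasingFrom_zero_iff hn, bval_one (by omega), bval_two hn]
  constructor
  · rintro ⟨⟨hD, hinc⟩, hneg⟩
    have hpos : ∀ i : Fin n, 1 ≤ (i : ℕ) → w.2 i = false := by
      intro i hi
      have h0 := hinc ⟨0, by omega⟩ ⟨1, hn⟩ (Nat.zero_le _) (by simp [Fin.lt_def])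
      have h1 : signedVal w ⟨1, hn⟩ ≤ signedVal w i := by
        rcases hi.eq_or_lt with h | h
        · rw [show i = ⟨1, hn⟩ from Fin.ext h.symm]
        · exact (hinc _ _ (Nat.zero_le _) h).le
      have h2 : 0 < signedVal w i := by omega
      by_contra hne
      rw [signedVal, if_pos (by simpa using hne)] at h2
      omega
    have hmono : ∀ i j : Fin n, i < j → w.1 i < w.1 j := by
      intro i j hij
      have hij' : (i : ℕ) < j := hij
      have hlt := hinc i j (Nat.zero_le _) hij
      have hj := hpos j (by omega)
      have hle : signedVal w ⟨1, hn⟩ ≤ signedVal w j := by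
        rcases (show 1 ≤ (j : ℕ) by omega).eq_or_lt with h | h
        · rw [show j = ⟨1, hn⟩ from Fin.ext h.symm]
        · exact (hinc _ _ (Nat.zero_le _) h).le
      have hne : (w.1 i : ℕ) ≠ w.1 j := fun h => hij.ne (w.1.injective (Fin.ext h))
      rw [Fin.lt_def]
      by_cases hi : 1 ≤ (i : ℕ)
      · simp only [signedVal, hj, hpos i hi] at hlt
        simp at hlt
        omega
      · obtain rfl : i = ⟨0, Nat.zero_lt_of_lt hn⟩ := Fin.ext (by simp; omega)
        have hneg' := hneg
        simp only [signedVal, hj] at hlt hle hneg'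
        simp only [Bool.false_eq_true, if_false] at hlt hle
        split_ifs at hlt hneg' hle <;> omega
    have hone : w.1 = 1 := by
      ext i
      exact congrArg Fin.val (congrFun (StrictMono.eq_id (f := w.1) fun i j => hmono i j) i)
    have hzero : w.2 ⟨0, by omega⟩ = false := by
      by_contra hne
      have hcard : negs w = 1 := by
        rw [negs_eq, card_eq_one]
        refine ⟨⟨0, by omega⟩, ?_⟩
        ext i
        rw [mem_filter, mem_singleton]
        constructor
        · rintro ⟨_, h⟩
          by_contra h'
          have := hpos i (by rw [Fin.ext_iff] at h'; simp at h'; omega)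
          simp [this] at h
        · rintro rfl
          exact ⟨mem_univ _, by simpa using hne⟩
      rw [DG, mem_filter, hcard] at hD
      exact absurd hD.2 (by decide)
    refine Prod.ext hone (funext fun i => ?_)
    by_cases hi : 1 ≤ (i : ℕ)
    · exact hpos i hi
    · obtain rfl : i = ⟨0, Nat.zero_lt_of_lt hn⟩ := Fin.ext (by simp; omega)
      exact hzero
  · rintro rfl
    refine ⟨⟨?_, ?_⟩, ?_⟩
    · simp [DG, negs_eq, identityBG]
    · intro i j _ hij
      rw [Fin.lt_def] at hij
      rw [signedVal_identityBG, signedVal_identityBG]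
      omega
    · rw [signedVal_identityBG, signedVal_identityBG]
      simp

lemma map_qFact {A B : Type*} [CommRing A] [CommRing B] (f : A →+* B) (k : ℕ) (q : A) :
    f (qFact k q) = qFact k (f q) := by
  simp [qFact, qInt]

lemma qFact_one (k : ℕ) : qFact k (1 : ℚ) = k.factorial := by
  simp [qFact, qInt, ← Finset.prod_range_add_one_eq_factorial]

lemma qFact_qK_ne_zero (k : ℕ) : qFact k qK ≠ 0 := by
  rw [qK, ← map_qFact, Ne, IsFractionRing.to_map_eq_zero_iff]
  intro h
  have := congrArg (MvPolynomial.eval fun _ => (1 : ℚ)) h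
  rw [map_qFact, MvPolynomial.eval_X, qFact_one, map_zero] at this
  exact k.factorial_ne_zero (by exact_mod_cast this)

lemma pow_two_indicators {A : Type*} [CommRing A] (t : A) (P Q : Prop) [Decidable P]
    [Decidable Q] :
    t ^ ((if P then 1 else 0) + (if Q then 1 else 0))
      = t ^ 2 + t * (1 - t) * ((if ¬ P then 1 else 0) + (if ¬ Q then 1 else 0))
        + (1 - t) ^ 2 * (if ¬ P ∧ ¬ Q then 1 else 0) := by
  by_cases hP : P <;> by_cases hQ : Q <;> simp [hP, hQ] <;> ring

lemma sum_increasingDG_one_weighted {A : Type*} [CommRing A] (t s q : A) {n : ℕ} (hn : 2 ≤ n) :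
    ∑ w ∈ increasingDG n 1, t ^ odesD w * s ^ edesD w * q ^ invD w
      = t ^ 2 * ∑ w ∈ increasingDG n 1, q ^ invD w
        + t * (1 - t) * (2 * ∑ w ∈ increasingDG n 0, q ^ invD w) + (1 - t) ^ 2 := by
  have hterm : ∀ w ∈ increasingDG n 1, t ^ odesD w * s ^ edesD w * q ^ invD w
      = t ^ 2 * q ^ invD w
        + t * (1 - t) * ((if ¬ bval w 2 < bval w 1 then q ^ invD w else 0)
          + (if ¬ bval w 2 < -bval w 1 then q ^ invD w else 0))
        + (1 - t) ^ 2 * (if ¬ bval w 2 < bval w 1 ∧ ¬ bval w 2 < -bval w 1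
          then q ^ invD w else 0) := by
    intro w hw
    have h := (increasingFrom_one_iff w).2 (mem_increasingDG.1 hw).2
    rw [odesD_eq hn h, edesD_eq_zero h, pow_two_indicators]
    split_ifs <;> ring
  rw [Finset.sum_congr rfl hterm, sum_add_distrib, sum_add_distrib, ← mul_sum, ← mul_sum,
    ← mul_sum, sum_add_distrib, ← sum_filter, ← sum_filter, ← sum_filter,
    filter_increasingDG_one hn, sum_filter_increasingDG_one_neg q hn,
    filter_increasingDG_one_both hn, sum_singleton, invD_identityBG]
  ring

theorem typeD_descents_in_one_minusone (n : ℕ) (hn : 2 ≤ n) :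
    ∑ w ∈ ((DG n).filter fun w : BG n =>
        ∀ j : ℕ, j < n → 2 ≤ j → bval w j < bval w (j + 1)),
      tK ^ odesD w * sK ^ edesD w * qK ^ invD w
    = tK ^ 2 * DOne n qK / qFact (n - 1) qK
      + tK * (1 - tK) * (2 * DOne n qK / qFact n qK - 1)
      + (1 - tK) := by
  have hX : ((DG n).filter fun w : BG n =>
      ∀ j : ℕ, j < n → 2 ≤ j → bval w j < bval w (j + 1)) = increasingDG n 1 := by
    ext w
    rw [mem_filter, mem_increasingDG, increasingFrom_one_iff]
  have h1 := sum_increasingDG_mul_qFact qK (n - 1) (Nat.sub_le n 1)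
  have h0 := sum_increasingDG_mul_qFact qK n le_rfl
  rw [show n - (n - 1) = 1 by omega] at h1
  rw [Nat.sub_self] at h0
  rw [hX, sum_increasingDG_one_weighted tK sK qK hn, mul_div_assoc, mul_div_assoc,
    ← eq_div_of_mul_eq (qFact_qK_ne_zero _) h1, ← eq_div_of_mul_eq (qFact_qK_ne_zero _) h0]
  ring

end
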